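/- arXiv:0710.2340 — 2 statements merged into one kernel-verified Lean document; each statement's English description precedes it below -/
import Mathlib

section
/- Let k ≥ s ≥ 3 be integers and let K be a totally real number field with F_{k,s} ⊆ K and K = ℚ(α), where α ≠ 0 is an algebraic integer. Let a_1, a_2 ≥ 0 with a := max{a_1, a_2} satisfying 0 < a < 16, let b_1 < b_2 be real numbers with b := max{|b_1|, |b_2|} ≥ a. Assume that for every real embedding σ : K → ℝ other than the identity one has −a_1·σ(sin²(π/k) sin²(π/s)) < σ(α) < a_2·σ(sin²(π/k) sin²(π/s)), while b_1 < α < b_2. Then N := [K : ℚ] satisfies N·(ln(4/√a) − ln γ(k)/φ(k) − ln γ(s)/φ(s)) < ln √(b/a) − ln sin(π/k) − ln sin(π/s), and moreover φ(lcm(k,s))/(2ρ(k,s)) divides N. -/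
open scoped Classical in
/-- `γ(l) = p` if `l = p^t` is a prime power (`t ≥ 1`), and `γ(l) = 1` otherwise. -/
noncomputable def gam (l : ℕ) : ℕ := if IsPrimePow l then l.minFac else 1

/-- `ρ(k,s) = 2` if `gcd(k,s) ∣ 2` and `ρ(k,s) = 1` otherwise. -/
def rho (k s : ℕ) : ℕ := if Nat.gcd k s ∣ 2 then 2 else 1

open Polynomial IntermediateField

/-- The value of the `n`-th cyclotomic polynomial at `1` is `γ(n)`. -/
lemma eval_one_cyclotomic_eq_gam {n : ℕ} (hn : 2 < n) :
    eval 1 (cyclotomic n ℤ) = (gam n : ℤ) := by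
  unfold gam
  split_ifs with h
  · obtain ⟨p, j, hp, hj, rfl⟩ := (isPrimePow_nat_iff n).1 h
    have := Fact.mk hp
    obtain ⟨i, rfl⟩ := Nat.exists_eq_succ_of_ne_zero hj.ne'
    rw [hp.pow_minFac i.succ_ne_zero]
    exact eval_one_cyclotomic_prime_pow i
  · refine eval_one_cyclotomic_not_prime_pow fun {p} hp j hj => h ?_
    rcases Nat.eq_zero_or_pos j with rfl | hj0
    · simp at hj; omega
    · exact (isPrimePow_nat_iff n).2 ⟨p, j, hp, hj0, hj⟩

lemma exists_norm_sub_one_eq_pow {F L : Type*} [Field F] [Field L] [Algebra F L]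
    [FiniteDimensional F L] {ζ : L} {n : ℕ} (hn : 2 < n) (hζ : IsPrimitiveRoot ζ n)
    (hirr : Irreducible (cyclotomic n F)) :
    ∃ m : ℕ, Module.finrank F L = n.totient * m ∧ Algebra.norm F (ζ - 1) = (gam n : F) ^ m := by
  have : NeZero n := ⟨by omega⟩
  have hcyc := hζ.intermediateField_adjoin_isCyclotomicExtension (K := F)
  have hgen : IsPrimitiveRoot (AdjoinSimple.gen F ζ) n := by
    refine IsPrimitiveRoot.of_map_of_injective (f := algebraMap F⟮ζ⟯ L) ?_
      (algebraMap F⟮ζ⟯ L).injective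
    simpa using hζ
  have hsub : ζ - 1 = algebraMap F⟮ζ⟯ L (AdjoinSimple.gen F ζ - 1) := by simp
  refine ⟨Module.finrank F⟮ζ⟯ L, ?_, ?_⟩
  · rw [← IsCyclotomicExtension.finrank F⟮ζ⟯ hirr, Module.finrank_mul_finrank]
  · rw [← Algebra.norm_norm (S := F⟮ζ⟯), hsub, Algebra.norm_algebraMap, map_pow,
      hgen.sub_one_norm_eq_eval_cyclotomic hn hirr, eval_one_cyclotomic_eq_gam hn, Int.cast_natCast]

section Fields

variable {K L : Type*} [Field K] [Field L] [Algebra ℚ K] [Algebra ℚ L] [Algebra K L]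

lemma totient_mul_log_norm_sub_one [FiniteDimensional ℚ L] {ζ : L} {n : ℕ} (hn : 2 < n)
    (hζ : IsPrimitiveRoot ζ n) :
    (n.totient : ℝ) * Real.log (Algebra.norm ℚ (ζ - 1) : ℚ) =
      Module.finrank ℚ L * Real.log (gam n) := by
  obtain ⟨m, hfin, hnorm⟩ :=
    exists_norm_sub_one_eq_pow hn hζ (cyclotomic.irreducible_rat (by omega))
  rw [hfin, hnorm]
  push_cast
  rw [Real.log_pow]
  ring

/-- The logarithmic form of `N_{K/ℚ}(2 - ζ - ζ⁻¹) = γ(n) ^ (2[K:ℚ]/φ(n))` for `ζ` a primitive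
`n`-th root of unity. -/
lemma totient_mul_log_norm_eq [FiniteDimensional ℚ K] [FiniteDimensional ℚ L]
    {ζ : L} {n : ℕ} (hn : 2 < n) (hζ : IsPrimitiveRoot ζ n) {x : K}
    (hx : algebraMap K L x = 2 - (ζ + ζ⁻¹)) :
    (n.totient : ℝ) * Real.log (Algebra.norm ℚ x : ℚ) =
      2 * (Module.finrank ℚ K * Real.log (gam n)) := by
  have : CharZero K := algebraRat.charZero K
  have : FiniteDimensional K L := FiniteDimensional.right ℚ K L
  have hζ0 : ζ ≠ 0 := hζ.ne_zero (by omega)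
  have hx' : algebraMap K L x = (ζ - 1) * (ζ⁻¹ - 1) := by
    rw [hx]; field_simp; ring
  have hne1 : ζ - 1 ≠ 0 := sub_ne_zero.2 (hζ.ne_one (by omega))
  have hne2 : ζ⁻¹ - 1 ≠ 0 := sub_ne_zero.2 (hζ.inv.ne_one (by omega))
  have hnorm : (Algebra.norm ℚ x) ^ Module.finrank K L =
      Algebra.norm ℚ (ζ - 1) * Algebra.norm ℚ (ζ⁻¹ - 1) := by
    rw [← map_mul, ← hx', ← Algebra.norm_norm (S := K) (R := ℚ) (a := algebraMap K L x),
      Algebra.norm_algebraMap, map_pow]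
  have hlog := congrArg (fun q : ℚ => Real.log q) hnorm
  have h1 := totient_mul_log_norm_sub_one hn hζ
  have h2 := totient_mul_log_norm_sub_one hn hζ.inv
  have hpos : (Module.finrank K L : ℝ) ≠ 0 := by exact_mod_cast Module.finrank_pos.ne'
  push_cast at hlog
  rw [Real.log_pow, Real.log_mul
    (by exact_mod_cast Algebra.norm_ne_zero_iff.2 hne1)
    (by exact_mod_cast Algebra.norm_ne_zero_iff.2 hne2)] at hlog
  rw [← Module.finrank_mul_finrank ℚ K L] at h1 h2
  push_cast at h1 h2
  apply mul_left_cancel₀ hpos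
  linear_combination (n.totient : ℝ) * hlog + h1 + h2

end Fields

section Quadratic

variable {K L : Type*} [Field K] [Field L] [Algebra K L]

lemma isIntegral_of_add_inv_eq {x : L} (hx : x ≠ 0) {t : K} (ht : algebraMap K L t = x + x⁻¹) :
    IsIntegral K x := by
  refine ⟨X ^ 2 - C t * X + 1, by monicity!, ?_⟩
  simp only [eval₂_add, eval₂_sub, eval₂_mul, eval₂_pow, eval₂_X, eval₂_C, eval₂_one, ht]
  field_simp
  ring

lemma finrank_adjoin_dvd_two {x : L} (hx : x ≠ 0) {t : K} (ht : algebraMap K L t = x + x⁻¹) :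
    Module.finrank K K⟮x⟯ ∣ 2 := by
  have hint := isIntegral_of_add_inv_eq hx ht
  have hdeg : (X ^ 2 - C t * X + 1 : K[X]).natDegree = 2 := by compute_degree!
  have hroot : aeval x (X ^ 2 - C t * X + 1 : K[X]) = 0 := by
    simp only [map_add, map_sub, map_mul, map_pow, aeval_X, aeval_C, map_one, ht]
    field_simp
    ring
  have hle : (minpoly K x).natDegree ≤ 2 :=
    hdeg ▸ natDegree_le_of_dvd (minpoly.dvd K x hroot) (by intro h; simp [h] at hdeg)
  have hpos := minpoly.natDegree_pos hint
  rw [adjoin.finrank hint]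
  interval_cases (minpoly K x).natDegree <;> norm_num

/-- `y ^ n - y⁻¹ ^ n` is a multiple of `y - y⁻¹` by a polynomial in `y + y⁻¹`. -/
lemma exists_pow_sub_inv_pow_eq {y : L} (hy : y ≠ 0) {u : K} (hu : algebraMap K L u = y + y⁻¹)
    (n : ℕ) : ∃ p : K, y ^ n - y⁻¹ ^ n = (y - y⁻¹) * algebraMap K L p := by
  induction n using Nat.twoStepInduction with
  | zero => exact ⟨0, by simp⟩
  | one => exact ⟨1, by simp⟩
  | more n ih₁ ih₂ =>
    obtain ⟨p, hp⟩ := ih₁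
    obtain ⟨q, hq⟩ := ih₂
    refine ⟨u * q - p, ?_⟩
    rw [map_sub, map_mul, hu, mul_sub, ← hp, mul_left_comm, ← hq]
    have h : y * y⁻¹ = 1 := mul_inv_cancel₀ hy
    linear_combination (y⁻¹ ^ n - y ^ n) * h

lemma mem_adjoin_of_pow_eq_pow [CharZero L] {x y : L} (hy : y ≠ 0) {u : K}
    (hu : algebraMap K L u = y + y⁻¹) {m n : ℕ} (hxy : x ^ m = y ^ n)
    (hsq : y ^ n ≠ y⁻¹ ^ n) : y ∈ K⟮x⟯ := by
  obtain ⟨p, hp⟩ := exists_pow_sub_inv_pow_eq hy hu n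
  have hp0 : algebraMap K L p ≠ 0 := by
    intro h
    rw [h, mul_zero, sub_eq_zero] at hp
    exact hsq hp
  have hxmem : x ∈ K⟮x⟯ := mem_adjoin_simple_self K x
  have hdiff : y - y⁻¹ ∈ K⟮x⟯ := by
    rw [eq_div_of_mul_eq hp0 hp.symm, inv_pow, ← hxy]
    exact div_mem (sub_mem (pow_mem hxmem m) (inv_mem (pow_mem hxmem m)))
      (K⟮x⟯.algebraMap_mem p)
  have hy2 : y = (algebraMap K L u + (y - y⁻¹)) / 2 := by rw [hu]; ring
  rw [hy2]
  exact div_mem (add_mem (K⟮x⟯.algebraMap_mem u) hdiff) (ofNat_mem _ 2)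

end Quadratic

/-- A field `K` whose image in `L` contains `x + x⁻¹` and `y + y⁻¹`, for primitive roots of unity
`x`, `y` of orders `k`, `s`, acquires both roots in an extension of degree dividing `2ρ(k,s)`. -/
lemma exists_extension_finrank_dvd {K L : Type} [Field K] [Field L] [CharZero L] [Algebra ℚ K]
    [FiniteDimensional ℚ K] [Algebra K L] {k s : ℕ} (hk : 3 ≤ k) (hs : 3 ≤ s) {x y : L}
    (hx : IsPrimitiveRoot x k) (hy : IsPrimitiveRoot y s) {t u : K}
    (ht : algebraMap K L t = x + x⁻¹) (hu : algebraMap K L u = y + y⁻¹) :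
    ∃ (M : Type) (_ : Field M) (_ : Algebra ℚ M) (_ : Algebra K M) (ξ η : M),
      FiniteDimensional ℚ M ∧ Module.finrank ℚ M ∣ Module.finrank ℚ K * (2 * rho k s) ∧
      IsPrimitiveRoot ξ k ∧ IsPrimitiveRoot η s ∧
      algebraMap K M t = ξ + ξ⁻¹ ∧ algebraMap K M u = η + η⁻¹ := by
  have hx0 : x ≠ 0 := hx.ne_zero (by omega)
  have hy0 : y ≠ 0 := hy.ne_zero (by omega)
  have hu' : algebraMap K⟮x⟯ L (algebraMap K K⟮x⟯ u) = y + y⁻¹ := by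
    rw [← IsScalarTower.algebraMap_apply, hu]
  have : FiniteDimensional K K⟮x⟯ := adjoin.finiteDimensional (isIntegral_of_add_inv_eq hx0 ht)
  have : FiniteDimensional K⟮x⟯ K⟮x⟯⟮y⟯ :=
    adjoin.finiteDimensional (isIntegral_of_add_inv_eq hy0 hu')
  have : FiniteDimensional K K⟮x⟯⟮y⟯ := FiniteDimensional.trans K K⟮x⟯ K⟮x⟯⟮y⟯
  have : CharZero K := algebraRat.charZero K
  let _ : Algebra ℚ K⟮x⟯⟮y⟯ := DivisionRing.toRatAlgebra
  have hinj : Function.Injective (algebraMap K⟮x⟯⟮y⟯ L) := (algebraMap K⟮x⟯⟮y⟯ L).injective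
  let ξ : K⟮x⟯⟮y⟯ := algebraMap K⟮x⟯ K⟮x⟯⟮y⟯ (AdjoinSimple.gen K x)
  let η : K⟮x⟯⟮y⟯ := AdjoinSimple.gen K⟮x⟯ y
  have hξ : algebraMap K⟮x⟯⟮y⟯ L ξ = x := rfl
  have hη : algebraMap K⟮x⟯⟮y⟯ L η = y := rfl
  have hKM : ∀ z : K, algebraMap K⟮x⟯⟮y⟯ L (algebraMap K K⟮x⟯⟮y⟯ z) = algebraMap K L z :=
    fun z => rfl
  refine ⟨K⟮x⟯⟮y⟯, inferInstance, inferInstance, inferInstance, ξ, η,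
    FiniteDimensional.trans ℚ K K⟮x⟯⟮y⟯, ?_, ?_, ?_, ?_, ?_⟩
  · rw [← Module.finrank_mul_finrank ℚ K K⟮x⟯⟮y⟯]
    refine mul_dvd_mul_left _ ?_
    have : Module.Free K⟮x⟯ K⟮x⟯⟮y⟯ := Module.Free.of_divisionRing _ _
    rw [← Module.finrank_mul_finrank K K⟮x⟯ K⟮x⟯⟮y⟯]
    refine mul_dvd_mul (finrank_adjoin_dvd_two hx0 ht) ?_
    unfold rho
    split_ifs with hg
    · exact finrank_adjoin_dvd_two hy0 hu'
    · have hgk := Nat.gcd_dvd_left k s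
      have hgs := Nat.gcd_dvd_right k s
      have hmem : y ∈ K⟮x⟯ := by
        have hgpos : 0 < k.gcd s := Nat.gcd_pos_of_pos_left s (by omega)
        have hxg : IsPrimitiveRoot (x ^ (k / k.gcd s)) (k.gcd s) :=
          hx.pow (by omega) (Nat.div_mul_cancel hgk).symm
        have hyg : IsPrimitiveRoot (y ^ (s / k.gcd s)) (k.gcd s) :=
          hy.pow (by omega) (Nat.div_mul_cancel hgs).symm
        have : NeZero (k.gcd s) := ⟨hgpos.ne'⟩
        obtain ⟨i, -, hi⟩ := hxg.eq_pow_of_pow_eq_one hyg.pow_eq_one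
        refine mem_adjoin_of_pow_eq_pow hy0 hu (by rw [pow_mul, hi]) fun h => hg ?_
        rw [inv_pow, ← mul_eq_one_iff_eq_inv₀ (pow_ne_zero _ hy0), ← sq] at h
        exact (hyg.pow_eq_one_iff_dvd 2).1 h
      have hbot : K⟮x⟯⟮y⟯ = ⊥ := adjoin_simple_eq_bot_iff.2 (mem_bot.2 ⟨⟨y, hmem⟩, rfl⟩)
      rw [hbot]
      exact (IntermediateField.finrank_bot (F := K⟮x⟯) (E := L)).dvd
  · exact IsPrimitiveRoot.of_map_of_injective (f := algebraMap K⟮x⟯⟮y⟯ L) (by rwa [hξ]) hinj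
  · exact IsPrimitiveRoot.of_map_of_injective (f := algebraMap K⟮x⟯⟮y⟯ L) (by rwa [hη]) hinj
  · apply hinj
    rw [map_add, map_inv₀, hξ, hKM, ht]
  · apply hinj
    rw [map_add, map_inv₀, hη, hKM, hu]

lemma two_mul_rho_dvd_totient_lcm {k s : ℕ} (hk : 3 ≤ k) (hs : 3 ≤ s) :
    2 * rho k s ∣ (k.lcm s).totient := by
  unfold rho
  split_ifs with hg
  · have h1 : (k.gcd s).totient = 1 := by
      rcases (Nat.dvd_prime Nat.prime_two).1 hg with h | h <;> simp [h]
    have h2 : (k.lcm s).totient = k.totient * s.totient := by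
      have h3 := Nat.totient_gcd_mul_totient_mul (k.gcd s) (k.lcm s)
      have h4 := Nat.totient_gcd_mul_totient_mul k s
      rw [Nat.gcd_mul_lcm, Nat.gcd_eq_left ((Nat.gcd_dvd_left k s).trans (Nat.dvd_lcm_left k s))]
        at h3
      rw [h1, one_mul, one_mul] at h3
      rw [h1, one_mul, h3] at h4
      exact Nat.eq_of_mul_eq_mul_right (Nat.gcd_pos_of_pos_left s (by omega)) h4
    rw [h2]
    exact mul_dvd_mul (Nat.totient_even (by omega)).two_dvd (Nat.totient_even (by omega)).two_dvd
  · have hle : k ≤ k.lcm s :=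
      Nat.le_of_dvd (Nat.lcm_pos (by omega) (by omega)) (Nat.dvd_lcm_left k s)
    simpa using (Nat.totient_even (by omega)).two_dvd

lemma totient_lcm_div_dvd {K M : Type*} [Field K] [Field M] [Algebra ℚ K] [Algebra ℚ M]
    [FiniteDimensional ℚ M] {k s : ℕ} (hk : 3 ≤ k) (hs : 3 ≤ s) {ξ η : M}
    (hξ : IsPrimitiveRoot ξ k) (hη : IsPrimitiveRoot η s)
    (hdvd : Module.finrank ℚ M ∣ Module.finrank ℚ K * (2 * rho k s)) :
    (k.lcm s).totient / (2 * rho k s) ∣ Module.finrank ℚ K := by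
  have hlcm : k ≤ k.lcm s :=
    Nat.le_of_dvd (Nat.lcm_pos (by omega) (by omega)) (Nat.dvd_lcm_left k s)
  obtain ⟨m, hm, -⟩ := exists_norm_sub_one_eq_pow (F := ℚ) (by omega)
    (hξ.pow_mul_pow_lcm hη (by omega) (by omega)) (cyclotomic.irreducible_rat (by omega))
  have hρ : 0 < 2 * rho k s := by unfold rho; split_ifs <;> norm_num
  refine Nat.dvd_of_mul_dvd_mul_right hρ ?_
  rw [Nat.div_mul_cancel (two_mul_rho_dvd_totient_lcm hk hs)]
  exact (Dvd.intro m hm.symm).trans hdvd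

lemma exists_real_embedding {K : Type*} [Field K] [Algebra ℚ K]
    (hreal : ∀ σ : K →+* ℂ, ∀ x : K, (σ x).im = 0) (σ : K →ₐ[ℚ] ℂ) :
    ∃ τ : K →+* ℝ, ∀ x, σ x = (τ x : ℂ) := by
  have h : NumberField.ComplexEmbedding.IsReal (σ : K →+* ℂ) := by
    rw [NumberField.ComplexEmbedding.isReal_iff]
    ext x
    exact Complex.conj_eq_iff_im.2 (hreal _ x)
  exact ⟨h.embedding, fun x => (h.coe_embedding_apply x).symm⟩

section Norm

variable {K : Type*} [Field K] [Algebra ℚ K] [FiniteDimensional ℚ K]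

lemma one_le_abs_norm_of_isIntegral {x : K} (hx : IsIntegral ℤ x) (hx0 : x ≠ 0) :
    1 ≤ |Algebra.norm ℚ x| := by
  obtain ⟨m, hm⟩ := IsIntegrallyClosed.isIntegral_iff.1 (Algebra.isIntegral_norm ℚ hx)
  have hne : Algebra.norm ℚ x ≠ 0 := Algebra.norm_ne_zero_iff.2 hx0
  rw [← hm] at hne ⊢
  simp only [eq_intCast, ne_eq, Int.cast_eq_zero] at hne ⊢
  exact_mod_cast Int.one_le_abs hne

lemma abs_norm_eq_prod_norm (x : K) :
    |((Algebra.norm ℚ x : ℚ) : ℝ)| = ∏ σ : K →ₐ[ℚ] ℂ, ‖σ x‖ := by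
  rw [← norm_prod, ← Algebra.norm_eq_prod_embeddings ℚ ℂ x]
  simp

/-- If every real embedding other than `ι` satisfies `|σ x| < a σ(y)` and `|ι x| < b`, then
`|N(x)| < b a ^ N |N(y)| / (a ι(y))` for a totally real field of degree `N`. -/
lemma abs_norm_mul_lt (hreal : ∀ σ : K →+* ℂ, ∀ x : K, (σ x).im = 0) (ι : K →+* ℝ) {x y : K}
    {a b : ℝ} (ha : 0 < a) (hx0 : x ≠ 0) (hxb : |ι x| < b) (hy : 0 < ι y)
    (h : ∀ σ : K →+* ℝ, σ ≠ ι → |σ x| < a * σ y) :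
    |((Algebra.norm ℚ x : ℚ) : ℝ)| * (a * ι y) <
      b * (a ^ Module.finrank ℚ K * |((Algebra.norm ℚ y : ℚ) : ℝ)|) := by
  classical
  let σ₀ : K →ₐ[ℚ] ℂ := (Complex.ofRealHom.comp ι).toRatAlgHom
  have hσ₀ : ∀ z, ‖σ₀ z‖ = |ι z| := fun z => Complex.norm_real (ι z)
  have hcard : a ^ Module.finrank ℚ K = ∏ _σ : K →ₐ[ℚ] ℂ, a := by
    rw [Finset.prod_const, Finset.card_univ, AlgHom.card]
  rw [hcard, abs_norm_eq_prod_norm x, abs_norm_eq_prod_norm y, ← Finset.prod_mul_distrib,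
    ← Finset.mul_prod_erase _ (fun σ : K →ₐ[ℚ] ℂ => ‖σ x‖) (Finset.mem_univ σ₀),
    ← Finset.mul_prod_erase _ (fun σ : K →ₐ[ℚ] ℂ => a * ‖σ y‖) (Finset.mem_univ σ₀),
    hσ₀, hσ₀, abs_of_pos hy]
  have hpos : ∀ σ : K →ₐ[ℚ] ℂ, 0 < ‖σ x‖ := fun σ => by simpa using hx0
  have hle : ∏ σ ∈ Finset.univ.erase σ₀, ‖σ x‖ ≤ ∏ σ ∈ Finset.univ.erase σ₀, a * ‖σ y‖ := by
    refine Finset.prod_le_prod (fun σ _ => norm_nonneg _) fun σ hσ => ?_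
    obtain ⟨τ, hτ⟩ := exists_real_embedding hreal σ
    have hne : τ ≠ ι := by
      rintro rfl
      exact Finset.ne_of_mem_erase hσ (AlgHom.ext hτ)
    rw [hτ, hτ, Complex.norm_real, Complex.norm_real, Real.norm_eq_abs, Real.norm_eq_abs]
    exact (h τ hne).le.trans (mul_le_mul_of_nonneg_left (le_abs_self _) ha.le)
  have hprod : 0 < ∏ σ ∈ Finset.univ.erase σ₀, ‖σ x‖ := Finset.prod_pos fun σ _ => hpos σ
  have hlt := mul_lt_mul hxb hle hprod ((abs_nonneg _).trans hxb.le)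
  have := mul_lt_mul_of_pos_right hlt (mul_pos ha hy)
  linarith

end Norm

lemma exp_add_inv_exp_eq (n : ℕ) :
    Complex.exp (2 * Real.pi * Complex.I / n) + (Complex.exp (2 * Real.pi * Complex.I / n))⁻¹ =
      ((2 * Real.cos (2 * Real.pi / n) : ℝ) : ℂ) := by
  rw [← Complex.exp_neg]
  push_cast
  rw [Complex.two_cos]
  ring_nf

lemma four_mul_sin_sq_eq (n : ℕ) :
    4 * Real.sin (Real.pi / n) ^ 2 = 2 - 2 * Real.cos (2 * Real.pi / n) := by
  rw [mul_div_assoc, Real.cos_two_mul, Real.cos_sq']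
  ring

lemma sin_pi_div_pos {n : ℕ} (hn : 3 ≤ n) : 0 < Real.sin (Real.pi / n) := by
  have h : (3 : ℝ) ≤ n := by exact_mod_cast hn
  refine Real.sin_pos_of_pos_of_lt_pi (by positivity) ?_
  exact div_lt_self Real.pi_pos (by linarith)

/-- **Case 2 norm estimate (Method B).** Let `k ≥ s ≥ 3`, and let `K = ℚ(α)` be a
totally real number field (realized inside `ℝ`) containing
`F_{k,s} = ℚ(cos(2π/k), cos(2π/s))`, where `α ≠ 0` is an algebraic integer with
`-a₁ σ(sin²(π/k) sin²(π/s)) < σ(α) < a₂ σ(sin²(π/k) sin²(π/s))` for every real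
embedding `σ ≠ id` and `b₁ < α < b₂`, where `a₁, a₂ ≥ 0`, `0 < a = max{a₁,a₂} < 16`,
`b₁ < b₂`, `b = max{|b₁|,|b₂|} ≥ a`.  Then `N = [K : ℚ]` satisfies
`N (ln(4/√a) - ln γ(k)/φ(k) - ln γ(s)/φ(s)) < ln √(b/a) - ln sin(π/k) - ln sin(π/s)`
and `φ(lcm(k,s))/(2ρ(k,s)) ∣ N`. -/
theorem nikulin_case2_estimate
    (k s : ℕ) (hs : 3 ≤ s) (hks : s ≤ k)
    (K : IntermediateField ℚ ℝ) [FiniteDimensional ℚ K]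
    (hKtotreal : ∀ σ : K →+* ℂ, ∀ x : K, (σ x).im = 0)
    (hcosk : Real.cos (2 * Real.pi / k) ∈ K)
    (hcoss : Real.cos (2 * Real.pi / s) ∈ K)
    (α : K) (hα0 : α ≠ 0) (hαint : IsIntegral ℤ (α : ℝ))
    (hKα : K = IntermediateField.adjoin ℚ {(α : ℝ)})
    (sks : K)
    (hsks : (sks : ℝ) = Real.sin (Real.pi / k) ^ 2 * Real.sin (Real.pi / s) ^ 2)
    (a₁ a₂ b₁ b₂ : ℝ) (ha₁ : 0 ≤ a₁) (ha₂ : 0 ≤ a₂)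
    (ha : 0 < max a₁ a₂) (ha16 : max a₁ a₂ < 16)
    (hb : b₁ < b₂) (hab : max a₁ a₂ ≤ max |b₁| |b₂|)
    (hσ : ∀ σ : K →+* ℝ, σ ≠ algebraMap K ℝ →
      -a₁ * σ sks < σ α ∧ σ α < a₂ * σ sks)
    (hgeo : b₁ < (α : ℝ) ∧ (α : ℝ) < b₂) :
    (Module.finrank ℚ K : ℝ) *
        (Real.log (4 / Real.sqrt (max a₁ a₂)) -
          Real.log (gam k) / (Nat.totient k : ℝ) -
          Real.log (gam s) / (Nat.totient s : ℝ)) <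
      Real.log (Real.sqrt (max |b₁| |b₂| / max a₁ a₂)) -
        Real.log (Real.sin (Real.pi / k)) - Real.log (Real.sin (Real.pi / s)) ∧
    Nat.totient (Nat.lcm k s) / (2 * rho k s) ∣ Module.finrank ℚ K := by
  have hk : 3 ≤ k := hs.trans hks
  set a := max a₁ a₂
  set b := max |b₁| |b₂|
  have hsk := sin_pi_div_pos hk
  have hss := sin_pi_div_pos hs
  let t : K := ⟨2 * Real.cos (2 * Real.pi / k), mul_mem (ofNat_mem K 2) hcosk⟩
  let u : K := ⟨2 * Real.cos (2 * Real.pi / s), mul_mem (ofNat_mem K 2) hcoss⟩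
  have ht : algebraMap K ℂ t = Complex.exp (2 * Real.pi * Complex.I / k) +
      (Complex.exp (2 * Real.pi * Complex.I / k))⁻¹ := (exp_add_inv_exp_eq k).symm
  have hu : algebraMap K ℂ u = Complex.exp (2 * Real.pi * Complex.I / s) +
      (Complex.exp (2 * Real.pi * Complex.I / s))⁻¹ := (exp_add_inv_exp_eq s).symm
  obtain ⟨M, _, _, _, ξ, η, hfin, hdvd, hξ, hη, hξt, hηu⟩ := exists_extension_finrank_dvd hk hs
    (Complex.isPrimitiveRoot_exp k (by omega)) (Complex.isPrimitiveRoot_exp s (by omega)) ht hu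
  refine ⟨?_, totient_lcm_div_dvd hk hs hξ hη hdvd⟩
  have hnk := totient_mul_log_norm_eq (x := 2 - t) hk hξ (by rw [map_sub, hξt, map_ofNat])
  have hns := totient_mul_log_norm_eq (x := 2 - u) hs hη (by rw [map_sub, hηu, map_ofNat])
  have hsks_pos : 0 < (sks : ℝ) := by rw [hsks]; positivity
  have hsks_mul : (algebraMap ℚ K 16) * sks = (2 - t) * (2 - u) := by
    apply Subtype.ext
    have h1 := four_mul_sin_sq_eq k
    have h2 := four_mul_sin_sq_eq s
    have : ((algebraMap ℚ K 16 : K) : ℝ) = 16 :=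
      (IsScalarTower.algebraMap_apply ℚ K ℝ 16).symm.trans (by simp)
    push_cast
    rw [this, hsks]
    change _ = (2 - 2 * Real.cos (2 * Real.pi / k)) * (2 - 2 * Real.cos (2 * Real.pi / s))
    rw [← h1, ← h2]
    ring
  have hsks0 : sks ≠ 0 := by rintro rfl; simp at hsks_pos
  have hprod0 : (2 - t) * (2 - u) ≠ 0 := by
    rw [← hsks_mul]; exact mul_ne_zero (by simp) hsks0
  have hlt := abs_norm_mul_lt hKtotreal (algebraMap K ℝ) (x := α) (y := sks) (b := b) ha hα0
    (by
      change |(α : ℝ)| < b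
      rw [abs_lt]
      have h1 := neg_abs_le b₁
      have h2 := le_abs_self b₂
      have h3 := le_max_left |b₁| |b₂|
      have h4 := le_max_right |b₁| |b₂|
      constructor <;> linarith [hgeo.1, hgeo.2])
    hsks_pos
    (by
      intro σ hne
      obtain ⟨h1, h2⟩ := hσ σ hne
      have hpos : 0 < σ sks := by
        have hsum : 0 < (a₁ + a₂) * σ sks := by linarith
        exact pos_of_mul_pos_right hsum (by positivity)
      have h3 := mul_le_mul_of_nonneg_right (le_max_left a₁ a₂) hpos.le
      have h4 := mul_le_mul_of_nonneg_right (le_max_right a₁ a₂) hpos.le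
      rw [abs_lt]
      constructor <;> linarith)
  have hα1 : (1 : ℝ) ≤ |((Algebra.norm ℚ α : ℚ) : ℝ)| := by
    exact_mod_cast one_le_abs_norm_of_isIntegral
      ((isIntegral_algHom_iff (IsScalarTower.toAlgHom ℤ K ℝ) (algebraMap K ℝ).injective).1 hαint)
      hα0
  have hb_pos : 0 < b := ha.trans_le hab
  have hNsks : ((Algebra.norm ℚ sks : ℚ) : ℝ) ≠ 0 := by
    exact_mod_cast Algebra.norm_ne_zero_iff.2 hsks0
  have hlt' : a * (sks : ℝ) < b * (a ^ Module.finrank ℚ K * |((Algebra.norm ℚ sks : ℚ) : ℝ)|) :=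
    (le_mul_of_one_le_left (by positivity) hα1).trans_lt hlt
  have hlog := Real.log_lt_log (by positivity) hlt'
  rw [Real.log_mul (by positivity) (by positivity), Real.log_mul (by positivity) (by positivity),
    Real.log_mul (by positivity) (by positivity), Real.log_pow, Real.log_abs, hsks,
    Real.log_mul (by positivity) (by positivity), Real.log_pow, Real.log_pow] at hlog
  have hnorm := congrArg (fun z => Real.log (Algebra.norm ℚ z : ℚ)) hsks_mul
  simp only [map_mul, Algebra.norm_algebraMap, Rat.cast_mul, Rat.cast_pow] at hnorm
  rw [Real.log_mul (by positivity) hNsks, Real.log_pow,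
    Real.log_mul
      (by exact_mod_cast Algebra.norm_ne_zero_iff.2 (left_ne_zero_of_mul hprod0))
      (by exact_mod_cast Algebra.norm_ne_zero_iff.2 (right_ne_zero_of_mul hprod0))] at hnorm
  have hlog16 : Real.log ((16 : ℚ) : ℝ) = 2 * Real.log 4 := by
    rw [← Real.log_rpow (by norm_num)]; norm_num
  rw [hlog16] at hnorm
  have hφk : (k.totient : ℝ) ≠ 0 := by exact_mod_cast (Nat.totient_pos.2 (by omega)).ne'
  have hφs : (s.totient : ℝ) ≠ 0 := by exact_mod_cast (Nat.totient_pos.2 (by omega)).ne'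
  rw [mul_comm, ← eq_div_iff hφk] at hnk
  rw [mul_comm, ← eq_div_iff hφs] at hns
  rw [hnk, hns] at hnorm
  rw [Real.log_div (by norm_num) (by positivity), Real.log_sqrt ha.le,
    Real.log_sqrt (by positivity), Real.log_div hb_pos.ne' ha.ne']
  push_cast at hlog
  have hgoal : (Module.finrank ℚ K : ℝ) * (Real.log 4 - Real.log a / 2 -
      Real.log (gam k) / k.totient - Real.log (gam s) / s.totient) =
      Module.finrank ℚ K * Real.log 4 - Module.finrank ℚ K * Real.log a / 2 -
      (2 * (Module.finrank ℚ K * Real.log (gam k)) / k.totient) / 2 -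
      (2 * (Module.finrank ℚ K * Real.log (gam s)) / s.totient) / 2 := by ring
  rw [hgoal]
  linarith
end

section
/- For integers k ≥ s ≥ 6, the inequality ln √2 − ln γ(k)/φ(k) − ln γ(s)/φ(s) ≤ 0 holds if and only if the pair (k, s) belongs to the following list: s = 7 and either k is a prime with 7 ≤ k ≤ 241 or k ∈ {8, 9, 16, 25, 27, 32, 49}; s = 8 and k ∈ {8, 9, 11, 13, 17}; s = 9 and k ∈ {9, 11, 13, 17, 19}; s = 11 and k is a prime with 11 ≤ k ≤ 31; s = 13 and k is a prime with 13 ≤ k ≤ 23; or (k, s) = (17, 17). -/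
theorem gam_prime_pow {p t : ℕ} (hp : p.Prime) (ht : t ≠ 0) : gam (p ^ t) = p := by
  rw [gam, if_pos (hp.isPrimePow.pow ht), hp.pow_minFac ht]

theorem gam_prime {p : ℕ} (hp : p.Prime) : gam p = p := by
  simpa using gam_prime_pow hp one_ne_zero

theorem gam_of_not_isPrimePow {n : ℕ} (hn : ¬ IsPrimePow n) : gam n = 1 :=
  if_neg hn

theorem gam_pos (n : ℕ) : 0 < gam n := by
  unfold gam
  split_ifs
  · exact n.minFac_pos
  · exact one_pos

theorem antitoneOn_log_div_sub_one :
    AntitoneOn (fun x : ℝ => Real.log x / (x - 1)) (Set.Ioi 1) := by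
  intro x hx y hy hxy
  have hx' : (1 : ℝ) < x := hx
  have hy' : (1 : ℝ) < y := hy
  have h := strictConcaveOn_log_Ioi.concaveOn.slope_anti (x := 1) (Set.mem_Ioi.2 one_pos)
    (a := x) (b := y) ⟨Set.mem_Ioi.2 (by linarith), hx'.ne'⟩
    ⟨Set.mem_Ioi.2 (by linarith), hy'.ne'⟩ hxy
  simpa [slope_def_field] using h

theorem pow_succ_sub_one_le {x : ℝ} (hx : 1 ≤ x) (t : ℕ) :
    x ^ (t + 1) - 1 ≤ (t + 1) * (x ^ t * (x - 1)) := by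
  induction t with
  | zero => simp
  | succ t ih =>
    have h := mul_le_mul_of_nonneg_left ih (by linarith : 0 ≤ x)
    have h1 := mul_le_mul_of_nonneg_right (one_le_pow₀ hx : 1 ≤ x ^ (t + 1)) (sub_nonneg.2 hx)
    push_cast
    simp only [pow_succ] at *
    nlinarith

theorem log_gam_div_totient_le {n : ℕ} (hn : 1 < n) :
    Real.log (gam n) / (n.totient : ℝ) ≤ Real.log n / (n - 1) := by
  have hn' : (1 : ℝ) < n := by exact_mod_cast hn
  by_cases h : IsPrimePow n
  · obtain ⟨p, t, hp, ht, rfl⟩ := (isPrimePow_nat_iff n).1 h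
    obtain ⟨t, rfl⟩ := Nat.exists_eq_add_one_of_ne_zero ht.ne'
    have hp1 : (1 : ℝ) < p := by exact_mod_cast hp.one_lt
    have hlog : 0 ≤ Real.log p := (Real.log_pos hp1).le
    have hφ : (0 : ℝ) < (p : ℝ) ^ t * (p - 1) := by
      have : (0 : ℝ) < p - 1 := by linarith
      positivity
    rw [gam_prime_pow hp ht.ne', Nat.totient_prime_pow hp ht]
    push_cast [Nat.cast_sub hp.one_le] at hn' ⊢
    rw [Real.log_pow, div_le_div_iff₀ hφ (by linarith)]
    have := mul_le_mul_of_nonneg_left (pow_succ_sub_one_le hp1.le t) hlog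
    push_cast
    linarith
  · rw [gam_of_not_isPrimePow h]
    simpa using div_nonneg (Real.log_nonneg hn'.le) (sub_nonneg.2 hn'.le)

theorem log_gam_div_totient_le_of_le {n N : ℕ} (hN : 1 < N) (hn : N ≤ n) :
    Real.log (gam n) / (n.totient : ℝ) ≤ Real.log N / ((N - 1 : ℕ) : ℝ) := by
  rw [Nat.cast_sub hN.le, Nat.cast_one]
  exact (log_gam_div_totient_le (hN.trans_le hn)).trans
    (antitoneOn_log_div_sub_one (Set.mem_Ioi.2 (by exact_mod_cast hN))
      (Set.mem_Ioi.2 (by exact_mod_cast hN.trans_le hn)) (by exact_mod_cast hn))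

theorem le_log_gam_div_totient_of_prime {p N : ℕ} (hp : p.Prime) (hN : p ≤ N) :
    Real.log N / ((N - 1 : ℕ) : ℝ) ≤ Real.log (gam p) / (p.totient : ℝ) := by
  rw [gam_prime hp, Nat.totient_prime hp, Nat.cast_sub hp.one_le,
    Nat.cast_sub (hp.one_le.trans hN), Nat.cast_one]
  exact antitoneOn_log_div_sub_one (Set.mem_Ioi.2 (by exact_mod_cast hp.one_lt))
    (Set.mem_Ioi.2 (by exact_mod_cast hp.one_lt.trans_le hN)) (by exact_mod_cast hN)

theorem log_sqrt_two_sub_le_iff {a b m n : ℕ} (ha : 0 < a) (hb : 0 < b) (hm : 0 < m)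
    (hn : 0 < n) :
    Real.log (Real.sqrt 2) - Real.log a / (m : ℝ) - Real.log b / (n : ℝ) ≤ 0 ↔
      2 ^ (m * n) ≤ a ^ (2 * n) * b ^ (2 * m) := by
  have hm' : (0 : ℝ) < m := by exact_mod_cast hm
  have hn' : (0 : ℝ) < n := by exact_mod_cast hn
  have ha' : (0 : ℝ) < a := by exact_mod_cast ha
  have hb' : (0 : ℝ) < b := by exact_mod_cast hb
  have hpow : 2 ^ (m * n) ≤ a ^ (2 * n) * b ^ (2 * m) ↔
      Real.log ((2 : ℝ) ^ (m * n)) ≤ Real.log ((a : ℝ) ^ (2 * n) * (b : ℝ) ^ (2 * m)) := by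
    rw [Real.log_le_log_iff (by positivity) (by positivity)]
    exact_mod_cast Iff.rfl
  rw [hpow, Real.log_mul (by positivity) (by positivity), Real.log_pow, Real.log_pow,
    Real.log_pow, Real.log_sqrt zero_le_two]
  have key : (m * n : ℝ) * 2 * (Real.log 2 / 2 - Real.log a / m - Real.log b / n) =
      m * n * Real.log 2 - (2 * n * Real.log a + 2 * m * Real.log b) := by
    field_simp
    ring
  push_cast
  rw [← sub_nonpos (a := (m * n : ℝ) * Real.log 2), ← key]
  exact (mul_nonpos_iff_pos_imp_nonpos.trans
    ⟨fun h => h.1 (by positivity), fun h => ⟨fun _ => h, fun _ => by positivity⟩⟩).symm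

/-- The inequality for `(k, s)`, cleared of logarithms and denominators. -/
def IsExceptional (k s : ℕ) : Prop :=
  2 ^ (k.totient * s.totient) ≤ gam k ^ (2 * s.totient) * gam s ^ (2 * k.totient)

theorem isExceptional_iff_log {k s : ℕ} (hk : 0 < k) (hs : 0 < s) :
    Real.log (Real.sqrt 2) - Real.log (gam k) / (k.totient : ℝ) -
      Real.log (gam s) / (s.totient : ℝ) ≤ 0 ↔ IsExceptional k s :=
  log_sqrt_two_sub_le_iff (gam_pos k) (gam_pos s) (Nat.totient_pos.2 hk) (Nat.totient_pos.2 hs)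

theorem not_isExceptional_of_le {k s N : ℕ} (hs : 0 < s) (hN : 1 < N) (hk : N ≤ k)
    (h : N ^ (2 * s.totient) * gam s ^ (2 * (N - 1)) < 2 ^ ((N - 1) * s.totient)) :
    ¬ IsExceptional k s := by
  rw [← isExceptional_iff_log (by lia) hs]
  rw [← not_le, ← log_sqrt_two_sub_le_iff (by lia) (gam_pos s) (by lia)
    (Nat.totient_pos.2 hs)] at h
  have := log_gam_div_totient_le_of_le hN hk
  linarith

theorem not_isExceptional_of_eighteen_le {k s : ℕ} (hs : 18 ≤ s) (hk : 18 ≤ k) :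
    ¬ IsExceptional k s := by
  rw [← isExceptional_iff_log (by lia) (by lia)]
  have h : ¬ 2 ^ ((18 - 1) * (18 - 1)) ≤ 18 ^ (2 * (18 - 1)) * 18 ^ (2 * (18 - 1)) := by
    decide +kernel
  rw [← log_sqrt_two_sub_le_iff (by lia) (by lia) (by lia) (by lia)] at h
  have h1 := log_gam_div_totient_le_of_le (by lia) hs
  have h2 := log_gam_div_totient_le_of_le (by lia) hk
  linarith

theorem isExceptional_of_prime {k s N : ℕ} (hs : 0 < s) (hp : k.Prime) (hk : k ≤ N)
    (h : 2 ^ ((N - 1) * s.totient) ≤ N ^ (2 * s.totient) * gam s ^ (2 * (N - 1))) :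
    IsExceptional k s := by
  have := hp.two_le
  rw [← isExceptional_iff_log (by lia) hs]
  rw [← log_sqrt_two_sub_le_iff (by lia) (gam_pos s) (by lia) (Nat.totient_pos.2 hs)] at h
  have := le_log_gam_div_totient_of_prime hp hk
  linarith

theorem not_isExceptional_of_not_isPrimePow {k s : ℕ} (hk : 0 < k) (hkp : ¬ IsPrimePow k)
    (h : gam s ^ 2 < 2 ^ s.totient) : ¬ IsExceptional k s := by
  rw [IsExceptional, gam_of_not_isPrimePow hkp, one_pow, one_mul, not_le, pow_mul,
    mul_comm, pow_mul]
  exact Nat.pow_lt_pow_left h (ne_of_gt (Nat.totient_pos.2 hk))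

/-- The proper prime powers `n` in `[6, 250]`, listed as `(n, γ(n), φ(n))`. -/
theorem prime_or_mem_of_isPrimePow {n : ℕ} (h : IsPrimePow n) (h6 : 6 ≤ n) (hn : n ≤ 250) :
    n.Prime ∨ (n, gam n, n.totient) ∈ ({(8, 2, 4), (16, 2, 8), (32, 2, 16), (64, 2, 32),
      (128, 2, 64), (9, 3, 6), (27, 3, 18), (81, 3, 54), (243, 3, 162), (25, 5, 20),
      (125, 5, 100), (49, 7, 42), (121, 11, 110), (169, 13, 156)} : Finset (ℕ × ℕ × ℕ)) := by
  obtain ⟨p, t, hp, ht, rfl⟩ := (isPrimePow_nat_iff n).1 h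
  rw [gam_prime_pow hp ht.ne', Nat.totient_prime_pow hp ht]
  obtain rfl | ht2 : t = 1 ∨ 2 ≤ t := by lia
  · simp [hp]
  right
  have hp15 : p ≤ 15 := by
    have := Nat.pow_le_pow_right hp.pos ht2
    nlinarith
  have ht7 : t ≤ 7 := by
    by_contra! h8
    have := Nat.pow_le_pow_right two_pos h8
    have := Nat.pow_le_pow_left hp.two_le t
    lia
  have := hp.two_le
  clear h
  interval_cases p <;> first
    | (exfalso; revert hp; norm_num; done)
    | (interval_cases t <;> first | (exfalso; lia) | decide)

theorem not_isExceptional_of_gam_eq_one {k s : ℕ} (hs : 0 < s) (hk : 7 ≤ k) (h : gam s = 1) :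
    ¬ IsExceptional k s := by
  refine not_isExceptional_of_le hs (by lia : 1 < 7) hk ?_
  rw [h, one_pow, mul_one, pow_mul, pow_mul]
  exact Nat.pow_lt_pow_left (by norm_num) (ne_of_gt (Nat.totient_pos.2 hs))

/-- The prime powers `n` in `[6, 36]`, listed as `(n, γ(n), φ(n))`. -/
theorem mem_of_isPrimePow_of_le {n : ℕ} (h : IsPrimePow n) (h6 : 6 ≤ n) (hn : n ≤ 36) :
    (n, gam n, n.totient) ∈ ({(7, 7, 6), (8, 2, 4), (9, 3, 6), (11, 11, 10), (13, 13, 12),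
      (16, 2, 8), (17, 17, 16), (19, 19, 18), (23, 23, 22), (25, 5, 20), (27, 3, 18),
      (29, 29, 28), (31, 31, 30), (32, 2, 16)} : Finset (ℕ × ℕ × ℕ)) := by
  obtain hp | hm := prime_or_mem_of_isPrimePow h h6 (by lia)
  · rw [gam_prime hp, Nat.totient_prime hp]
    clear h
    interval_cases n <;> first
      | decide
      | (exfalso; revert hp; norm_num)
  · simp only [Finset.mem_insert, Finset.mem_singleton, Prod.mk.injEq] at hm
    rcases hm with h | h | h | h | h | h | h | h | h | h | h | h | h | h <;> first
      | (rw [h.2.1, h.2.2, h.1]; decide)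
      | (exfalso; lia)

/-- For integers `k ≥ s ≥ 6`, the inequality
`ln √2 - ln γ(k)/φ(k) - ln γ(s)/φ(s) ≤ 0` holds iff the pair `(k, s)` is one of:
`s = 7` with `k` prime, `7 ≤ k ≤ 241`, or `k ∈ {8, 9, 16, 25, 27, 32, 49}`;
`s = 8` with `k ∈ {8, 9, 11, 13, 17}`; `s = 9` with `k ∈ {9, 11, 13, 17, 19}`;
`s = 11` with `k` prime, `11 ≤ k ≤ 31`; `s = 13` with `k` prime, `13 ≤ k ≤ 23`;
or `(k, s) = (17, 17)`. -/
theorem exceptional_pairs_sqrt_two (k s : ℕ) (hs : 6 ≤ s) (hks : s ≤ k) :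
    Real.log (Real.sqrt 2) - Real.log (gam k) / (Nat.totient k : ℝ) -
        Real.log (gam s) / (Nat.totient s : ℝ) ≤ 0 ↔
      (s = 7 ∧ ((Nat.Prime k ∧ 7 ≤ k ∧ k ≤ 241) ∨
          k ∈ ({8, 9, 16, 25, 27, 32, 49} : Set ℕ))) ∨
      (s = 8 ∧ k ∈ ({8, 9, 11, 13, 17} : Set ℕ)) ∨
      (s = 9 ∧ k ∈ ({9, 11, 13, 17, 19} : Set ℕ)) ∨
      (s = 11 ∧ Nat.Prime k ∧ 11 ≤ k ∧ k ≤ 31) ∨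
      (s = 13 ∧ Nat.Prime k ∧ 13 ≤ k ∧ k ≤ 23) ∨
      (k = 17 ∧ s = 17) := by
  rw [isExceptional_iff_log (by lia) (by lia)]
  simp only [Set.mem_insert_iff, Set.mem_singleton_iff]
  obtain hs18 | hs17 := le_or_gt 18 s
  · exact iff_of_false (not_isExceptional_of_eighteen_le hs18 (by lia)) (by lia)
  by_cases hsp : IsPrimePow s
  swap
  · have hsl : ∀ n ∈ ({7, 8, 9, 11, 13, 17} : Finset ℕ), IsPrimePow n := by decide +kernel
    have hs1 := gam_of_not_isPrimePow hsp
    refine iff_of_false ?_ fun h => hsp (hsl s (by simp; lia))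
    obtain rfl | hk : k = 6 ∨ 7 ≤ k := by lia
    · refine not_isExceptional_of_not_isPrimePow (by lia) (by decide +kernel) ?_
      rw [hs1, one_pow]
      exact Nat.one_lt_two_pow (Nat.totient_pos.2 (by lia)).ne'
    · exact not_isExceptional_of_gam_eq_one (by lia) hk hs1
  have hsm := mem_of_isPrimePow_of_le hsp hs (by lia)
  simp only [Finset.mem_insert, Finset.mem_singleton, Prod.mk.injEq] at hsm
  by_cases hkp : IsPrimePow k
  swap
  · refine iff_of_false (not_isExceptional_of_not_isPrimePow (by lia) hkp ?_) ?_
    · obtain h | h | h | h | h | h | h | h := hsm <;> first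
        | (rw [h.2.1, h.2.2]; norm_num)
        | lia
    · have hkl : ∀ n ∈ ({8, 9, 11, 13, 16, 17, 19, 25, 27, 32, 49} : Finset ℕ),
          IsPrimePow n := by decide +kernel
      have hnp : ¬ k.Prime := fun h => hkp h.isPrimePow
      intro h
      refine hkp (hkl k ?_)
      simp only [Finset.mem_insert, Finset.mem_singleton]
      lia
  obtain ⟨rfl, hgs, hφs⟩ | hsm := hsm
  · obtain hk | hk := le_or_gt 251 k
    · refine iff_of_false (not_isExceptional_of_le (by lia) (by lia) hk ?_) (by lia)
      rw [hgs, hφs]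
      decide +kernel
    obtain hp | hm := prime_or_mem_of_isPrimePow hkp (by lia) (by lia)
    · have hk241 : k ≤ 241 := by
        by_contra!
        clear hkp
        interval_cases k <;> revert hp <;> norm_num
      refine iff_of_true (isExceptional_of_prime (by lia) hp hk241 ?_)
        (Or.inl ⟨rfl, Or.inl ⟨hp, hks, hk241⟩⟩)
      rw [hgs, hφs]
      decide +kernel
    · simp only [Finset.mem_insert, Finset.mem_singleton, Prod.mk.injEq] at hm
      rcases hm with h | h | h | h | h | h | h | h | h | h | h | h | h | h <;>
      · obtain ⟨rfl, hgk, hφk⟩ := h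
        rw [IsExceptional, hgs, hφs, hgk, hφk]
        decide +kernel
  obtain ⟨rfl, hgs, hφs⟩ | ⟨rfl, hgs, hφs⟩ | ⟨rfl, hgs, hφs⟩ | ⟨rfl, hgs, hφs⟩ |
    ⟨rfl, hgs, hφs⟩ | ⟨rfl, hgs, hφs⟩ | hsm := hsm
  case inr.inr.inr.inr.inr.inr => lia
  all_goals
    obtain hk | hk := le_or_gt 37 k
    · refine iff_of_false (not_isExceptional_of_le (by lia) (by lia) hk ?_) (by lia)
      rw [hgs, hφs]
      decide +kernel
    have hkm := mem_of_isPrimePow_of_le hkp (by lia) (by lia)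
    simp only [Finset.mem_insert, Finset.mem_singleton, Prod.mk.injEq] at hkm
    rcases hkm with h | h | h | h | h | h | h | h | h | h | h | h | h | h <;>
    · obtain ⟨rfl, hgk, hφk⟩ := h
      simp only [IsExceptional, hgs, hφs, hgk, hφk]
      first
        | decide +kernel
        | (exfalso; lia)
end
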